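/- arXiv:2201.08242 — 7 statements merged into one kernel-verified Lean document; each statement's English description precedes it below -/
import Mathlib

section
/- With the matrix M defined as in the context, if Z^{q^2} ≠ Z and Y·Z^{q^2+q} = ρ for some ρ ∈ L with ρ ≠ 0 and ρ^q = ρ, then the rank of M (as a matrix over L) equals 6. -/
open Polynomial in
/-- Partial fractions with simple poles plus an affine part: such a function on a field that vanishes
at more points than the degree of its numerator has only zero coefficients. -/
lemma partialFraction_coeff_eq_zero {F ι κ : Type*} [Field F] [Fintype ι] [Fintype κ]
    [DecidableEq ι] {z : ι → F} (hz : Function.Injective z) {t : κ → F}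
    (ht : Function.Injective t) (hcard : Fintype.card ι + 1 < Fintype.card κ)
    (hne : ∀ j i, t j + z i ≠ 0) {a b : F} {e : ι → F}
    (h : ∀ j, a + b * t j + ∑ i, e i * (1 / (t j + z i)) = 0) :
    a = 0 ∧ b = 0 ∧ ∀ i, e i = 0 := by
  set P : F[X] := (C a + C b * X) * ∏ i, (X + C (z i)) +
    ∑ i, C (e i) * ∏ k ∈ Finset.univ.erase i, (X + C (z k)) with hP
  have hprod : ∀ s : Finset ι, (∏ k ∈ s, (X + C (z k))).natDegree ≤ s.card := fun s =>
    (natDegree_prod_le _ _).trans (by simp)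
  have hdeg : P.natDegree ≤ Fintype.card ι + 1 := by
    refine (natDegree_add_le _ _).trans (max_le ?_ ?_)
    · refine natDegree_mul_le.trans ?_
      have h1 : (C a + C b * X).natDegree ≤ 1 := by compute_degree
      have h2 := hprod Finset.univ
      rw [Finset.card_univ] at h2
      omega
    · refine natDegree_sum_le_of_forall_le _ _ fun i _ => ?_
      refine (natDegree_C_mul_le _ _).trans ((hprod _).trans ?_)
      exact (Finset.card_le_univ _).trans (Nat.le_succ _)
  have heval : ∀ j, P.eval (t j) = 0 := by
    intro j
    have hterm : ∀ i, e i * ∏ k ∈ Finset.univ.erase i, (t j + z k) =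
        e i * (1 / (t j + z i)) * ∏ k, (t j + z k) := by
      intro i
      rw [← Finset.mul_prod_erase Finset.univ _ (Finset.mem_univ i)]
      have := hne j i
      field_simp
    simp only [hP, eval_add, eval_mul, eval_prod, eval_finsetSum, eval_C, eval_X, hterm]
    rw [← Finset.sum_mul, ← add_mul, h j, zero_mul]
  have hP0 : P = 0 :=
    eq_zero_of_natDegree_lt_card_of_eval_eq_zero P ht heval (by omega)
  have he : ∀ i, e i = 0 := by
    intro i
    have h0 : P.eval (-z i) = 0 := by rw [hP0, eval_zero]
    simp only [hP, eval_add, eval_mul, eval_prod, eval_finsetSum, eval_C, eval_X] at h0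
    rw [Finset.prod_eq_zero (Finset.mem_univ i) (by ring), mul_zero, zero_add,
      Finset.sum_eq_single i, mul_eq_zero, Finset.prod_eq_zero_iff] at h0
    · rcases h0 with h0 | ⟨k, hk, h0⟩
      · exact h0
      · exact absurd (hz (by linear_combination h0)) (Finset.ne_of_mem_erase hk)
    · intro k _ hk
      rw [Finset.prod_eq_zero (Finset.mem_erase.2 ⟨hk.symm, Finset.mem_univ i⟩) (by ring), mul_zero]
    · simp
  simp only [he, zero_mul, Finset.sum_const_zero, add_zero] at h
  obtain ⟨j, k, hjk⟩ := Fintype.exists_pair_of_one_lt_card (show 1 < Fintype.card κ by omega)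
  have hb : b = 0 := by
    have h0 : b * (t j - t k) = 0 := by linear_combination h j - h k
    exact (mul_eq_zero.1 h0).resolve_right (sub_ne_zero.2 (ht.ne hjk))
  exact ⟨by simpa [hb] using h j, hb, he⟩

/-- Partial fraction decomposition of `(t + x) (t + y) / (t + s)`, normalised to `1` at `t = 0`. -/
lemma normalised_quotient_eq {F : Type*} [Field F] {x y s t : F} (hts : t + s ≠ 0) :
    (t + x) / x * ((t + y) / y) / ((t + s) / s) =
      s / (x * y) * (t + (x + y - s) + (x - s) * (y - s) * (1 / (t + s))) := by
  field_simp
  ring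


/-- Case (R3): if `Z ∉ F_{q^2}` and `Y = ρ/Z^(q^2+q)` with `ρ ∈ F_q^*`, then `rank M = 6`.  Here `|K| = q`, `|L| = q^4`,
`N l = l·Z^(q^2)·Y^q + 1` and `D l = l·Z^(q^2)·Y + 1`, and `lam 0, …, lam 7`
play the role of `λ_1, …, λ_8` in the `10×10` matrix `M` of the paper. -/
theorem stmt_8 (q : ℕ) (K L : Type*) [Field K] [Field L] [Algebra K L]
    [Fintype K] [Fintype L]
    (hK : Fintype.card K = q) (hL : Fintype.card L = q ^ 4)
    (Y Z : L) (lam : Fin 8 → L)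
    (hinj : Function.Injective lam) (hne : ∀ j, lam j ≠ 0)
    (hfq : ∀ j, lam j ^ q = lam j)
    (N D : L → L)
    (hN : ∀ l : L, N l = l * Z ^ q ^ 2 * Y ^ q + 1)
    (hD : ∀ l : L, D l = l * Z ^ q ^ 2 * Y + 1)
    (hN0 : ∀ j, N (lam j) ≠ 0) (hD0 : ∀ j, D (lam j) ≠ 0)
    (M : Matrix (Fin 10) (Fin 10) L)
    (hM0 : ∀ j : Fin 8, M 0 ⟨j.1, by omega⟩ = 1)
    (hM0' : M 0 8 = 0) (hM0'' : M 0 9 = 1)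
    (hM1 : ∀ j : Fin 8, M 1 ⟨j.1, by omega⟩ = lam j)
    (hM1' : M 1 8 = 1) (hM1'' : M 1 9 = 0)
    (hMa : ∀ (i : Fin 4) (j : Fin 8), M ⟨2 + i.1, by omega⟩ ⟨j.1, by omega⟩ =
      (D (lam j) ^ (q ^ 2 + q + 1) / N (lam j) ^ (q + 1)) ^ q ^ i.1)
    (hMa' : ∀ i : Fin 4, M ⟨2 + i.1, by omega⟩ 8 = (Y * Z) ^ q ^ i.1)
    (hMa'' : ∀ i : Fin 4, M ⟨2 + i.1, by omega⟩ 9 = 1)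
    (hMb : ∀ (i : Fin 4) (j : Fin 8), M ⟨6 + i.1, by omega⟩ ⟨j.1, by omega⟩ =
      (D (lam j) ^ (q ^ 2 + q) / N (lam j) ^ q) ^ q ^ i.1)
    (hMb' : ∀ i : Fin 4, M ⟨6 + i.1, by omega⟩ 8 = (Y ^ q * Z) ^ q ^ i.1)
    (hMb'' : ∀ i : Fin 4, M ⟨6 + i.1, by omega⟩ 9 = 1)
    (h1 : Z ^ q ^ 2 ≠ Z) (h2 : ∃ ρ : L, ρ ≠ 0 ∧ ρ ^ q = ρ ∧ Y * Z ^ (q ^ 2 + q) = ρ) :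
    M.rank = 6 := by
  classical
  obtain ⟨ρ, hρ0, hρ, hY⟩ := h2
  let φ : L →+* L := (FiniteField.frobeniusAlgHom K L : L →ₐ[K] L)
  have hφ : ∀ x, φ x = x ^ q := fun x => by simp [φ, ← hK]
  have hqadd : ∀ x y : L, (x + y) ^ q = x ^ q + y ^ q := fun x y => by
    simp only [← hφ, map_add]
  have hinjq : ∀ {x y : L}, x ^ q = y ^ q → x = y := fun {x y} h =>
    φ.injective (by rw [hφ, hφ, h])
  have hfrob : ∀ x : L, x ^ q ^ 4 = x := fun x => hL ▸ FiniteField.pow_card x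
  -- the conjugates of `Z`
  let z : ℕ → L := fun n => Z ^ q ^ n
  have hzs : ∀ n, z n ^ q = z (n + 1) := fun n => by simp only [z, ← pow_mul, ← pow_succ]
  have hz4 : ∀ n, z (n + 4) = z n := fun n => by
    simp only [z]
    rw [pow_add, pow_mul, hfrob]
  have hq0 : q ≠ 0 := hK ▸ Fintype.card_ne_zero
  have hZ0 : Z ≠ 0 := by
    rintro rfl
    exact h1 (zero_pow (pow_ne_zero 2 hq0))
  have hz0 : ∀ n, z n ≠ 0 := fun n => pow_ne_zero _ hZ0
  have hzne2 : ∀ n, z (n + 2) ≠ z n := by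
    intro n
    induction n with
    | zero => simpa [z] using h1
    | succ n ih =>
      intro h
      exact ih (hinjq (by rw [hzs, hzs, ← h]))
  have hzne1 : ∀ n, z (n + 1) ≠ z n := by
    intro n h
    refine hzne2 n ?_
    rw [← hzs (n + 1), h, hzs, h]
  have hzne3 : ∀ n, z (n + 3) ≠ z n := fun n h => hzne1 (n + 3) (by rw [h, hz4])
  have hzinj : Function.Injective fun i : Fin 4 => z i := by
    have hlt : ∀ i j : Fin 4, i < j → z i ≠ z j := by
      intro i j hij h
      obtain h' | h' | h' : (j : ℕ) = i + 1 ∨ (j : ℕ) = i + 2 ∨ (j : ℕ) = i + 3 := by omega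
      · exact hzne1 i (by rw [← h', h])
      · exact hzne2 i (by rw [← h', h])
      · exact hzne3 i (by rw [← h', h])
    intro i j h
    rcases lt_trichotomy i j with hij | hij | hij
    · exact absurd h (hlt i j hij)
    · exact hij
    · exact absurd h.symm (hlt j i hij)
  have hYz : Y = ρ / (z 1 * z 2) := by
    rw [eq_div_iff (mul_ne_zero (hz0 1) (hz0 2)), ← hY, pow_add]
    simp only [z, pow_one]
    ring
  have hYq : Y ^ q = ρ / (z 2 * z 3) := by rw [hYz, div_pow, mul_pow, hρ, hzs, hzs]
  -- the evaluation points, and the factors of `N` and `D` there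
  let t : Fin 8 → L := fun j => lam j * ρ
  have htinj : Function.Injective t := fun i j h => hinj (mul_right_cancel₀ hρ0 h)
  have htq : ∀ j, t j ^ q = t j := fun j => by simp only [t, mul_pow, hfq, hρ]
  have has : ∀ j n, (t j + z n) ^ q = t j + z (n + 1) := fun j n => by rw [hqadd, htq, hzs]
  let b : Fin 8 → ℕ → L := fun j n => (t j + z n) / z n
  have hbs : ∀ j n m, b j n ^ q ^ m = b j (n + m) := by
    intro j n m
    induction m with
    | zero => simp
    | succ m ih => rw [pow_succ, pow_mul, ih]; simp only [b, div_pow, has, hzs]; rfl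
  have hb1 : ∀ j n, b j n ^ q = b j (n + 1) := fun j n => by simpa using hbs j n 1
  have hb4 : ∀ j n, b j (n + 4) = b j n := fun j n => by simp only [b, hz4]
  have hDb : ∀ j, D (lam j) = b j 1 := by
    intro j
    have h1 := hz0 1
    have h2 := hz0 2
    rw [hD, hYz]
    change lam j * z 2 * _ + 1 = _
    simp only [b, t]
    field_simp
  have hNb : ∀ j, N (lam j) = b j 3 := by
    intro j
    have h2 := hz0 2
    have h3 := hz0 3
    rw [hN, hYq]
    change lam j * z 2 * _ + 1 = _
    simp only [b, t]
    field_simp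
  have hbne : ∀ j n, b j n ≠ 0 := by
    intro j n h
    have h3 : b j (4 * n + 3) = 0 := by
      rw [show 4 * n + 3 = n + (3 * n + 3) by ring, ← hbs, h, zero_pow (pow_ne_zero _ hq0)]
    have h4 : ∀ m, b j (4 * m + 3) = b j 3 := by
      intro m
      induction m with
      | zero => rfl
      | succ m ih => rw [← ih, ← hb4 j (4 * m + 3)]; ring_nf
    refine hN0 j ?_
    rw [hNb, ← h4 n, h3]
  have hane : ∀ j n, t j + z n ≠ 0 := fun j n h => hbne j n (by simp [b, h])
  -- the entries of `M` in terms of conjugates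
  have hA : ∀ (i : Fin 4) (j : Fin 8), M ⟨2 + i.1, by omega⟩ ⟨j.1, by omega⟩ =
      b j (i + 1) * b j (i + 2) / b j i := by
    intro i j
    have h3 := hbne j (3 + i)
    rw [hMa, hDb, hNb]
    simp only [pow_add, pow_one, div_pow, mul_pow, hbs, hb1]
    rw [show 3 + 1 + (i : ℕ) = i + 4 by ring, hb4, show 1 + 2 + (i : ℕ) = 3 + i by ring,
      show 1 + 1 + (i : ℕ) = i + 2 by ring, add_comm 1 (i : ℕ)]
    have h0 := hbne j i
    field_simp
  have hB : ∀ (i : Fin 4) (j : Fin 8), M ⟨6 + i.1, by omega⟩ ⟨j.1, by omega⟩ =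
      b j (i + 2) * b j (i + 3) / b j i := by
    intro i j
    rw [hMb, hDb, hNb]
    simp only [pow_add, div_pow, mul_pow, hbs, hb1]
    rw [show 3 + 1 + (i : ℕ) = i + 4 by ring, hb4, show 1 + 2 + (i : ℕ) = i + 3 by ring,
      show 1 + 1 + (i : ℕ) = i + 2 by ring, mul_comm (b j (i + 2))]
  have hzm : ∀ n m, z n ^ q ^ m = z (n + m) := fun n m => by
    simp only [z, ← pow_mul, ← pow_add]
  have hρm : ∀ m, ρ ^ q ^ m = ρ := by
    intro m
    induction m with
    | zero => simp
    | succ m ih => rw [pow_succ, pow_mul, ih, hρ]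
  have hA8 : ∀ i : Fin 4, M ⟨2 + i.1, by omega⟩ 8 = ρ * z i / (z (i + 1) * z (i + 2)) := by
    intro i
    rw [hMa', hYz, mul_pow, div_pow, mul_pow, hzm, hzm, hρm, add_comm 1, add_comm 2]
    exact div_mul_eq_mul_div _ _ _
  have hB8 : ∀ i : Fin 4, M ⟨6 + i.1, by omega⟩ 8 = ρ * z i / (z (i + 2) * z (i + 3)) := by
    intro i
    rw [hMb', hYq, mul_pow, div_pow, mul_pow, hzm, hzm, hρm, add_comm 2, add_comm 3]
    exact div_mul_eq_mul_div _ _ _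
  have hcol : ∀ k : Fin 10, (∃ j : Fin 8, k = ⟨j.1, by omega⟩) ∨ k = 8 ∨ k = 9 := by
    intro k
    by_cases hk : k.1 < 8
    · exact Or.inl ⟨⟨k.1, hk⟩, rfl⟩
    · right
      simp only [Fin.ext_iff]
      change k.1 = 8 ∨ k.1 = 9
      omega
  -- the simple fractions `1 / (t + z i)`, with their values at `∞` and `0`
  let w : Fin 4 → Fin 10 → L := fun i k =>
    if h : k.1 < 8 then 1 / (t ⟨k.1, h⟩ + z i) else if k = 8 then 0 else 1 / z i
  have hw : ∀ (i : Fin 4) (j : Fin 8), w i ⟨j.1, by omega⟩ = 1 / (t j + z i) := fun i j => by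
    simp [w]
  have hw8 : ∀ i, w i 8 = 0 := fun i => by simp [w]
  have hw9 : ∀ i, w i 9 = 1 / z i := fun i => by simp [w]
  have hrow : ∀ (r : Fin 10 → L) (i : Fin 4) (m n : ℕ),
      (∀ j : Fin 8, r ⟨j.1, by omega⟩ = b j m * b j n / b j i) →
      r 8 = ρ * z i / (z m * z n) → r 9 = 1 →
      r = (z i / (z m * z n)) • (ρ • M 1 + (z m + z n - z i) • M 0 +
        ((z m - z i) * (z n - z i)) • w i) := by
    intro r i m n hr hr8 hr9
    funext k
    simp only [Pi.smul_apply, Pi.add_apply, smul_eq_mul]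
    obtain ⟨j, rfl⟩ | rfl | rfl := hcol k
    · rw [hr, hM1, hM0, hw, normalised_quotient_eq (hane j i), mul_comm ρ, mul_one]
    · rw [hr8, hM1', hM0', hw8]
      ring
    · have hi := hz0 i
      have hm := hz0 m
      have hn := hz0 n
      rw [hr9, hM1'', hM0'', hw9]
      field_simp
      ring
  have hrowA := fun i : Fin 4 =>
    hrow (M ⟨2 + i.1, by omega⟩) i (i + 1) (i + 2) (hA i) (hA8 i) (hMa'' i)
  have hrowB := fun i : Fin 4 =>
    hrow (M ⟨6 + i.1, by omega⟩) i (i + 2) (i + 3) (hB i) (hB8 i) (hMb'' i)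
  let W : Fin 2 ⊕ Fin 4 → Fin 10 → L := Sum.elim ![M 0, M 1] w
  have hW : LinearIndependent L W := by
    rw [Fintype.linearIndependent_iff]
    intro g hg
    simp only [Fintype.sum_sum_type, Fin.sum_univ_two, W, Sum.elim_inl, Sum.elim_inr,
      Matrix.cons_val_zero, Matrix.cons_val_one] at hg
    obtain ⟨ha, hb, he⟩ := partialFraction_coeff_eq_zero (a := g (Sum.inl 0))
      (b := g (Sum.inl 1) / ρ) (e := fun i => g (Sum.inr i)) hzinj htinj (by simp)
      (fun j i => hane j i) (by
        intro j
        have h := congrFun hg ⟨j.1, by omega⟩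
        simp only [Pi.add_apply, Pi.smul_apply, smul_eq_mul, Finset.sum_apply, hM0, hM1, hw,
          Pi.zero_apply] at h
        rw [← h]
        simp only [t]
        field_simp)
    rintro (i | i)
    · fin_cases i
      · exact ha
      · exact (div_eq_zero_iff.1 hb).resolve_right hρ0
    · exact he i
  have hspan : Submodule.span L (Set.range M.row) = Submodule.span L (Set.range W) := by
    apply le_antisymm
    · have h0 : M 0 ∈ Submodule.span L (Set.range W) := Submodule.subset_span ⟨Sum.inl 0, rfl⟩
      have h1 : M 1 ∈ Submodule.span L (Set.range W) := Submodule.subset_span ⟨Sum.inl 1, rfl⟩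
      have hwi : ∀ i, w i ∈ Submodule.span L (Set.range W) := fun i =>
        Submodule.subset_span ⟨Sum.inr i, rfl⟩
      have hcomb : ∀ (c d e f : L) (i : Fin 4), c • (d • M 1 + e • M 0 + f • w i) ∈
          Submodule.span L (Set.range W) := fun c d e f i =>
        Submodule.smul_mem _ _ (add_mem (add_mem (Submodule.smul_mem _ _ h1)
          (Submodule.smul_mem _ _ h0)) (Submodule.smul_mem _ _ (hwi i)))
      rw [Submodule.span_le]
      rintro _ ⟨k, rfl⟩
      change M k ∈ Submodule.span L (Set.range W)
      obtain rfl | rfl | ⟨i, rfl⟩ | ⟨i, rfl⟩ : k = 0 ∨ k = 1 ∨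
          (∃ i : Fin 4, k = ⟨2 + i.1, by omega⟩) ∨ ∃ i : Fin 4, k = ⟨6 + i.1, by omega⟩ := by
        by_cases k0 : k.1 = 0
        · exact Or.inl (Fin.ext k0)
        by_cases k1 : k.1 = 1
        · exact Or.inr (Or.inl (Fin.ext k1))
        by_cases k6 : k.1 < 6
        · exact Or.inr (Or.inr (Or.inl ⟨⟨k.1 - 2, by omega⟩, Fin.ext (by dsimp only; omega)⟩))
        · exact Or.inr (Or.inr (Or.inr ⟨⟨k.1 - 6, by omega⟩, Fin.ext (by dsimp only; omega)⟩))
      · exact h0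
      · exact h1
      · rw [hrowA]
        exact hcomb _ _ _ _ _
      · rw [hrowB]
        exact hcomb _ _ _ _ _
    · have hM : ∀ k, M k ∈ Submodule.span L (Set.range M.row) := fun k =>
        Submodule.subset_span ⟨k, rfl⟩
      rw [Submodule.span_le]
      rintro _ ⟨i | i, rfl⟩
      · fin_cases i
        · exact hM 0
        · exact hM 1
      · have hres := mul_ne_zero (sub_ne_zero.2 (hzne1 i)) (sub_ne_zero.2 (hzne2 i))
        have hα := div_ne_zero (hz0 i) (mul_ne_zero (hz0 (i + 1)) (hz0 (i + 2)))
        have h := hM ⟨2 + i.1, by omega⟩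
        rw [hrowA, Submodule.smul_mem_iff _ hα, Submodule.add_mem_iff_right _
          (add_mem (Submodule.smul_mem _ _ (hM 1)) (Submodule.smul_mem _ _ (hM 0))),
          Submodule.smul_mem_iff _ hres] at h
        exact h
  rw [Matrix.rank_eq_finrank_span_row, hspan, finrank_span_eq_card hW]
  rfl
end

section
/- Let K be the field with 2 elements and let L be a field extension of K with 8 elements. Then the tensor rank of the Gabidulin code G = {x ↦ a·x + b·x^2 : a, b ∈ L} equals 7; that is, 7 is the least natural number R for which there exist R rank-one K-linear maps f_1, …, f_R : L → L such that G is contained in the K-linear span of {f_1, …, f_R}. In particular, G is a minimum tensor rank code (it attains the Kruskal lower bound 6 + 2 − 1 = 7). -/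
section
variable {K L : Type*} [Field K] [Field L] [Algebra K L] [Fintype K]

/-- The `K`-linear parametrization `(a, b) ↦ (x ↦ a * x + b * x ^ |K|)` of the Gabidulin code. -/
noncomputable def gabidulinMap (K L : Type*) [Field K] [Field L] [Algebra K L] [Fintype K] :
    L × L →ₗ[K] (L →ₗ[K] L) :=
  (LinearMap.mul K L).coprod
    ((LinearMap.lcomp K L (FiniteField.frobeniusAlgHom K L).toLinearMap).comp (LinearMap.mul K L))

theorem gabidulinMap_apply (hK : Fintype.card K = 2) (p : L × L) (x : L) :
    gabidulinMap K L p x = p.1 * x + p.2 * x ^ 2 := by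
  simp [gabidulinMap, hK]

theorem eq_zero_of_two_roots {L : Type*} [Field L] {a b x y : L} (hx : x ≠ 0) (hy : y ≠ 0)
    (hxy : x ≠ y)
    (h₁ : a * x + b * x ^ 2 = 0) (h₂ : a * y + b * y ^ 2 = 0) : a = 0 ∧ b = 0 := by
  have h₁' : a + b * x = 0 := mul_left_cancel₀ hx (by linear_combination h₁)
  have h₂' : a + b * y = 0 := mul_left_cancel₀ hy (by linear_combination h₂)
  have hb : b = 0 := mul_left_cancel₀ (sub_ne_zero.2 hxy) (by linear_combination h₁' - h₂')
  exact ⟨by simpa [hb] using h₁', hb⟩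

variable [Fintype L]

/-- The rank-one map `x ↦ v ^ 3 * Tr (v * x)`. -/
noncomputable def traceForm (v : Lˣ) : L →ₗ[K] L :=
  ((Algebra.trace K L).comp (LinearMap.mulLeft K (v : L))).smulRight ((v : L) ^ 3)

theorem finrank_range_traceForm (v : Lˣ) :
    Module.finrank K (LinearMap.range (traceForm (K := K) v)) = 1 := by
  have hv : ((v : L) ^ 3) ≠ 0 := pow_ne_zero _ v.ne_zero
  have h : LinearMap.range (traceForm (K := K) v) = Submodule.span K {(v : L) ^ 3} := by
    ext y
    simp only [traceForm, LinearMap.mem_range, LinearMap.smulRight_apply, LinearMap.comp_apply,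
      LinearMap.mulLeft_apply, Submodule.mem_span_singleton]
    constructor
    · rintro ⟨x, rfl⟩
      exact ⟨_, rfl⟩
    · rintro ⟨c, rfl⟩
      obtain ⟨x, rfl⟩ := Algebra.trace_surjective K L c
      exact ⟨(v : L)⁻¹ * x, by simp⟩
  rw [h, finrank_span_singleton hv]

theorem finrank_eq_three (hK : Fintype.card K = 2) (hL : Fintype.card L = 8) :
    Module.finrank K L = 3 := by
  have h := Module.card_eq_pow_finrank (K := K) (V := L)
  rw [hK, hL] at h
  exact (Nat.pow_right_injective le_rfl (h.symm.trans (by norm_num : 8 = 2 ^ 3)))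

theorem algebraMap_trace_eq (hK : Fintype.card K = 2) (hL : Fintype.card L = 8) (x : L) :
    algebraMap K L (Algebra.trace K L x) = x + x ^ 2 + x ^ 4 := by
  rw [FiniteField.algebraMap_trace_eq_sum_pow, finrank_eq_three hK hL, Nat.card_eq_fintype_card, hK]
  simp [Finset.sum_range_succ]

theorem sum_pow_units_eq_zero [DecidableEq L] (hL : Fintype.card L = 8) {i : ℕ} (hi : ¬ 7 ∣ i) :
    ∑ v : Lˣ, (v : L) ^ i = 0 := by
  have h := FiniteField.sum_pow_units L i
  rw [hL] at h
  simpa [hi] using h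

theorem sum_trace_smul_traceForm [DecidableEq L] (hK : Fintype.card K = 2)
    (hL : Fintype.card L = 8) (a b x : L) :
    ∑ v : Lˣ, (Algebra.trace K L (a * v ^ 3) + Algebra.trace K L (b * v ^ 2)) •
      traceForm (K := K) v x = a * x + b * x ^ 2 := by
  have hcard : Fintype.card Lˣ = 7 := by rw [Fintype.card_units, hL]
  have h8 : (8 : L) = 0 := by
    have := FiniteField.cast_card_eq_zero L
    rw [hL] at this
    exact_mod_cast this
  have h2 : (2 : L) = 0 := by
    have : (2 : L) ^ 3 = 0 := by rw [← h8]; norm_num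
    exact pow_eq_zero_iff (by norm_num) |>.1 this
  have key (v : Lˣ) : (Algebra.trace K L (a * v ^ 3) + Algebra.trace K L (b * v ^ 2)) •
      traceForm (K := K) v x = (a * x + b * x ^ 2)
      + (a * x ^ 2 + b ^ 2 * x + b ^ 4 * x ^ 4) * (v : L) ^ 1
      + (a ^ 4 * x + b * x ^ 4 + b ^ 2 * x ^ 2) * (v : L) ^ 2
      + (a * x ^ 4 + a ^ 2 * x + a ^ 4 * x ^ 2) * (v : L) ^ 3
      + (a ^ 2 * x ^ 2 + b ^ 2 * x ^ 4) * (v : L) ^ 4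
      + (a ^ 4 * x ^ 4 + b ^ 4 * x) * (v : L) ^ 5
      + (a ^ 2 * x ^ 4 + b * x + b ^ 4 * x ^ 2) * (v : L) ^ 6 := by
    have hv : (v : L) ^ 7 = 1 := by
      have := pow_card_eq_one (x := v)
      rw [hcard] at this
      simpa using congrArg Units.val this
    simp only [traceForm, LinearMap.smulRight_apply, LinearMap.comp_apply,
      LinearMap.mulLeft_apply, Algebra.smul_def, map_add, algebraMap_trace_eq hK hL]
    grind
  simp only [key, Finset.sum_add_distrib, ← Finset.mul_sum]
  rw [sum_pow_units_eq_zero hL (by norm_num), sum_pow_units_eq_zero hL (by norm_num),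
    sum_pow_units_eq_zero hL (by norm_num), sum_pow_units_eq_zero hL (by norm_num),
    sum_pow_units_eq_zero hL (by norm_num), sum_pow_units_eq_zero hL (by norm_num)]
  simp only [Finset.sum_const, Finset.card_univ, hcard, nsmul_eq_mul]
  linear_combination (3 * (a * x + b * x ^ 2)) * h2

theorem gabidulinMap_eq_zero (hK : Fintype.card K = 2) {p : L × L}
    (hp : 2 ≤ Module.finrank K (LinearMap.ker (gabidulinMap K L p))) : p = 0 := by
  classical
  have hc : 2 < Nat.card (LinearMap.ker (gabidulinMap K L p)) := by
    rw [Module.natCard_eq_pow_finrank (K := K), Nat.card_eq_fintype_card, hK]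
    exact lt_of_lt_of_le (by norm_num) (Nat.pow_le_pow_right (by norm_num) hp)
  rw [Nat.card_eq_fintype_card, Fintype.two_lt_card_iff] at hc
  obtain ⟨x, y, z, hxy, hxz, hyz⟩ := hc
  have hroot (w : LinearMap.ker (gabidulinMap K L p)) : p.1 * (w : L) + p.2 * (w : L) ^ 2 = 0 := by
    rw [← gabidulinMap_apply hK]
    exact w.2
  have hne {u w : LinearMap.ker (gabidulinMap K L p)} (hu : (u : L) ≠ 0) (hw : (w : L) ≠ 0)
      (huw : u ≠ w) : p = 0 :=
    Prod.ext_iff.2 (eq_zero_of_two_roots hu hw (Subtype.coe_injective.ne huw) (hroot u) (hroot w))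
  by_cases hx : (x : L) = 0
  · have hy : (y : L) ≠ 0 := fun h => hxy (Subtype.ext (hx.trans h.symm))
    have hz : (z : L) ≠ 0 := fun h => hxz (Subtype.ext (hx.trans h.symm))
    exact hne hy hz hyz
  · by_cases hy : (y : L) = 0
    · exact hne hx (fun h => hyz (Subtype.ext (hy.trans h.symm))) hxz
    · exact hne hx hy hxy

theorem gabidulinMap_injective (hK : Fintype.card K = 2) (hL : Fintype.card L = 8) :
    Function.Injective (gabidulinMap K L) :=
  (injective_iff_map_eq_zero _).2 fun p hp => gabidulinMap_eq_zero hK <| by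
    rw [hp, LinearMap.ker_zero, finrank_top, finrank_eq_three hK hL]
    norm_num

theorem finrank_range_gabidulinMap (hK : Fintype.card K = 2) (hL : Fintype.card L = 8) :
    Module.finrank K (LinearMap.range (gabidulinMap K L)) = 6 := by
  rw [LinearMap.finrank_range_of_inj (gabidulinMap_injective hK hL), Module.finrank_prod,
    finrank_eq_three hK hL]

theorem finrank_range_ne_one_of_mem (hK : Fintype.card K = 2) (hL : Fintype.card L = 8)
    {g : L →ₗ[K] L} (hg : g ∈ LinearMap.range (gabidulinMap K L)) :
    Module.finrank K (LinearMap.range g) ≠ 1 := by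
  obtain ⟨p, rfl⟩ := hg
  intro h
  have hker := LinearMap.finrank_range_add_finrank_ker (gabidulinMap K L p)
  rw [finrank_eq_three hK hL, h] at hker
  obtain rfl := gabidulinMap_eq_zero hK (p := p) (by omega)
  rw [map_zero, LinearMap.range_zero, finrank_bot] at h
  exact zero_ne_one h

end

/-- The tensor rank of the Gabidulin code `G_{2,1} = {x ↦ a·x + b·x^2}` in
`L/K` with `|K| = 2` and `|L| = 8` equals `7`; in particular it is MTR. -/
theorem stmt_10 (K L : Type*) [Field K] [Field L] [Algebra K L]
    [Fintype K] [Fintype L]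
    (hK : Fintype.card K = 2) (hL : Fintype.card L = 8) :
    IsLeast {R : ℕ | ∃ f : Fin R → (L →ₗ[K] L),
      (∀ i, Module.finrank K (LinearMap.range (f i)) = 1) ∧
      ∀ g : L →ₗ[K] L, (∃ a b : L, ∀ x : L, g x = a * x + b * x ^ 2) →
        g ∈ Submodule.span K (Set.range f)} 7 := by
  classical
  constructor
  · have hcard : Fintype.card Lˣ = 7 := by rw [Fintype.card_units, hL]
    let e : Fin 7 ≃ Lˣ := (Fintype.equivFinOfCardEq hcard).symm
    refine ⟨fun i => traceForm (e i), fun i => finrank_range_traceForm _, ?_⟩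
    rintro g ⟨a, b, hg⟩
    have hsum : g = ∑ v : Lˣ, (Algebra.trace K L (a * v ^ 3) + Algebra.trace K L (b * v ^ 2)) •
        traceForm (K := K) v := by
      ext x
      rw [hg, ← sum_trace_smul_traceForm hK hL a b x]
      simp
    rw [hsum]
    exact Submodule.sum_mem _ fun v _ => Submodule.smul_mem _ _
      (Submodule.subset_span ⟨e.symm v, by simp⟩)
  · rintro R ⟨f, hf, hspan⟩
    by_contra! hR
    have hle : LinearMap.range (gabidulinMap K L) ≤ Submodule.span K (Set.range f) := by
      rintro _ ⟨p, rfl⟩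
      exact hspan _ ⟨p.1, p.2, gabidulinMap_apply hK p⟩
    have hrank : Module.finrank K (Submodule.span K (Set.range f)) ≤ R := by
      simpa [Set.finrank] using finrank_range_le_card (R := K) f
    have hsix := finrank_range_gabidulinMap hK hL
    have hmono := Submodule.finrank_mono hle
    have heq := Submodule.eq_of_le_of_finrank_le hle (by omega)
    have hmem : f ⟨0, by omega⟩ ∈ LinearMap.range (gabidulinMap K L) :=
      heq ▸ Submodule.subset_span ⟨_, rfl⟩
    exact finrank_range_ne_one_of_mem hK hL hmem (hf _)
end

section
/- Let K be the field with 2 elements and let L be a field extension of K with 16 elements. Then the tensor rank of the Gabidulin code G = {x ↦ a·x + b·x^2 + c·x^4 : a, b, c ∈ L} equals 13; that is, 13 is the least natural number R for which there exist R rank-one K-linear maps f_1, …, f_R : L → L such that G is contained in the K-linear span of {f_1, …, f_R}. In particular, G is a minimum tensor rank code (it attains the Kruskal lower bound 12 + 2 − 1 = 13). -/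
section GabidulinTensorRank

open Module Submodule

variable (K L : Type*) [Field K] [Field L] [Algebra K L] [Fintype K]

/-- The `K`-linear map sending `(a, b, c)` to the evaluation map
`x ↦ a * x + b * x ^ q + c * x ^ q ^ 2`, where `q = |K|`. -/
noncomputable def gabidulinEncode : (L × L × L) →ₗ[K] (L →ₗ[K] L) :=
  let φ : L →ₗ[K] L := (FiniteField.frobeniusAlgHom K L).toLinearMap
  (LinearMap.mul K L).coprod
    (((LinearMap.mul K L).compl₂ φ).coprod ((LinearMap.mul K L).compl₂ (φ ∘ₗ φ)))

variable {K L}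

theorem gabidulinEncode_apply (hK : Fintype.card K = 2) (a b c x : L) :
    gabidulinEncode K L (a, b, c) x = a * x + b * x ^ 2 + c * x ^ 4 := by
  simp [gabidulinEncode, hK, ← pow_mul, add_assoc]

variable [Fintype L]

theorem finrank_of_card_two_sixteen (hK : Fintype.card K = 2) (hL : Fintype.card L = 16) :
    finrank K L = 4 := by
  have h := Module.card_eq_pow_finrank (K := K) (V := L)
  rw [hK, hL, show 16 = 2 ^ 4 by norm_num] at h
  exact (Nat.pow_right_injective le_rfl h).symm

open Polynomial in
/-- A nonzero codeword has at most four roots, hence range of dimension at least two. -/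
theorem gabidulinEncode_eq_zero_of_finrank_range_le_one
    (hK : Fintype.card K = 2) (hL : Fintype.card L = 16) (v : L × L × L)
    (hv : finrank K (LinearMap.range (gabidulinEncode K L v)) ≤ 1) : v = 0 := by
  classical
  obtain ⟨a, b, c⟩ := v
  set g := gabidulinEncode K L (a, b, c) with hg
  have hdim := g.finrank_range_add_finrank_ker
  rw [finrank_of_card_two_sixteen hK hL] at hdim
  have hker : 8 ≤ Fintype.card (LinearMap.ker g) := by
    rw [Module.card_eq_pow_finrank (K := K), hK]
    calc 8 = 2 ^ 3 := by norm_num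
      _ ≤ _ := Nat.pow_le_pow_right two_pos (by omega)
  set p : L[X] := C a * X + C b * X ^ 2 + C c * X ^ 4 with hp
  have hdeg : p.natDegree ≤ 4 := by rw [hp]; compute_degree
  have hp0 : p = 0 := by
    by_contra h0
    have hsub : Fintype.card (LinearMap.ker g) ≤ p.roots.toFinset.card := by
      rw [← Fintype.card_coe]
      refine Fintype.card_le_of_injective (fun x => ⟨x.1, ?_⟩) fun x y hxy => ?_
      · have hx : g x.1 = 0 := x.2
        simp only [hg, gabidulinEncode_apply hK] at hx
        rw [Multiset.mem_toFinset, mem_roots h0, IsRoot.def]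
        simpa [hp] using hx
      · exact Subtype.ext (congrArg (fun z => z.1) hxy)
    have := p.roots.toFinset_card_le
    have := p.card_roots'
    omega
  have h1 := congrArg (coeff · 1) hp0
  have h2 := congrArg (coeff · 2) hp0
  have h4 := congrArg (coeff · 4) hp0
  simp [hp, coeff_X_pow] at h1 h2 h4
  simp [h1, h2, h4]

theorem gabidulinEncode_injective (hK : Fintype.card K = 2) (hL : Fintype.card L = 16) :
    Function.Injective (gabidulinEncode K L) := by
  rw [injective_iff_map_eq_zero]
  intro v hv
  refine gabidulinEncode_eq_zero_of_finrank_range_le_one hK hL v ?_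
  rw [hv, LinearMap.range_zero, finrank_bot]
  exact zero_le_one

theorem finrank_range_gabidulinEncode (hK : Fintype.card K = 2) (hL : Fintype.card L = 16) :
    finrank K (LinearMap.range (gabidulinEncode K L)) = 12 := by
  rw [LinearMap.finrank_range_of_inj (gabidulinEncode_injective hK hL)]
  simp [finrank_of_card_two_sixteen hK hL]

/-- The Kruskal bound: rank-one maps whose span contains the code number at least `13`. -/
theorem thirteen_le_of_range_gabidulinEncode_le_span
    (hK : Fintype.card K = 2) (hL : Fintype.card L = 16) {R : ℕ} (f : Fin R → (L →ₗ[K] L))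
    (hf : ∀ i, finrank K (LinearMap.range (f i)) = 1)
    (hspan : LinearMap.range (gabidulinEncode K L) ≤ span K (Set.range f)) : 13 ≤ R := by
  by_contra! hR
  have h12 := finrank_range_gabidulinEncode hK hL
  have hcard : finrank K (span K (Set.range f)) ≤ R := by
    simpa [Set.finrank] using finrank_range_le_card (R := K) f
  have hle := Submodule.finrank_mono hspan
  have heq := Submodule.eq_of_le_of_finrank_le hspan (by omega)
  have hmem : f ⟨0, by omega⟩ ∈ LinearMap.range (gabidulinEncode K L) :=
    heq ▸ subset_span (Set.mem_range_self _)
  obtain ⟨v, hv⟩ := hmem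
  have h1 := hf ⟨0, by omega⟩
  have hv0 := gabidulinEncode_eq_zero_of_finrank_range_le_one hK hL v (by rw [hv, h1])
  rw [← hv, hv0, map_zero, LinearMap.range_zero, finrank_bot] at h1
  exact zero_ne_one h1

variable (K) in
/-- The rank-one map `x ↦ Tr(βx) β ^ 7`; when `|L| = 16`, `β ^ 7 = β ^ (-8)`. -/
noncomputable def traceRankOne (β : Lˣ) : L →ₗ[K] L :=
  ((Algebra.trace K L) ∘ₗ LinearMap.mulLeft K (β : L)).smulRight ((β : L) ^ 7)

theorem finrank_range_traceRankOne (β : Lˣ) :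
    finrank K (LinearMap.range (traceRankOne K β)) = 1 := by
  obtain ⟨y, hy⟩ := Algebra.trace_surjective K L 1
  have hrange : LinearMap.range (traceRankOne K β) = span K {(β : L) ^ 7} := by
    apply le_antisymm
    · rintro _ ⟨x, rfl⟩
      exact smul_mem _ _ (mem_span_singleton_self _)
    · rw [span_singleton_le_iff_mem]
      exact ⟨(β : L)⁻¹ * y, by simp [traceRankOne, hy]⟩
  rw [hrange, finrank_span_singleton (pow_ne_zero _ β.ne_zero)]

theorem algebraMap_trace_of_card_two_sixteen
    (hK : Fintype.card K = 2) (hL : Fintype.card L = 16) (x : L) :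
    algebraMap K L (Algebra.trace K L x) = ∑ i ∈ Finset.range 4, x ^ 2 ^ i := by
  rw [FiniteField.algebraMap_trace_eq_sum_pow, finrank_of_card_two_sixteen hK hL,
    Nat.card_eq_fintype_card, hK]

theorem units_pow_fifteen (hL : Fintype.card L = 16) (β : Lˣ) : (β : L) ^ 15 = 1 := by
  simpa [hL] using FiniteField.pow_card_sub_one_eq_one (β : L) β.ne_zero

theorem traceRankOne_apply (hK : Fintype.card K = 2) (hL : Fintype.card L = 16)
    (β : Lˣ) (x : L) :
    traceRankOne K β x = (β : L) ^ 8 * x + (β : L) ^ 9 * x ^ 2 + (β : L) ^ 11 * x ^ 4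
      + (β : L) ^ 15 * x ^ 8 := by
  rw [traceRankOne, LinearMap.smulRight_apply, Algebra.smul_def, LinearMap.comp_apply,
    algebraMap_trace_of_card_two_sixteen hK hL]
  simp only [Finset.sum_range_succ, Finset.sum_range_zero, LinearMap.mulLeft_apply]
  ring

theorem sum_units_pow_of_card_sixteen [DecidableEq L]
    (hK : Fintype.card K = 2) (hL : Fintype.card L = 16)
    (i : ℕ) : ∑ β : Lˣ, (β : L) ^ i = if 15 ∣ i then 1 else 0 := by
  have h2 : (2 : L) = 0 := by
    have h : (2 : K) = 0 := by simpa [hK] using FiniteField.cast_card_eq_zero K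
    rw [← map_ofNat (algebraMap K L) 2, h, map_zero]
  have h11 : (-1 : L) = 1 := by linear_combination -h2
  rw [FiniteField.sum_pow_units, hL, h11]

theorem sum_trace_mul_pow [DecidableEq L]
    (hK : Fintype.card K = 2) (hL : Fintype.card L = 16)
    (a : L) (k m : ℕ) :
    ∑ β : Lˣ, algebraMap K L (Algebra.trace K L (a * (β : L) ^ k)) * (β : L) ^ m =
      ∑ i ∈ Finset.range 4, a ^ 2 ^ i * if 15 ∣ k * 2 ^ i + m then 1 else 0 := by
  simp_rw [algebraMap_trace_of_card_two_sixteen hK hL, Finset.sum_mul]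
  rw [Finset.sum_comm]
  refine Finset.sum_congr rfl fun i _ => ?_
  rw [← sum_units_pow_of_card_sixteen hK hL, Finset.mul_sum]
  exact Finset.sum_congr rfl fun β _ => by rw [mul_pow, pow_add, pow_mul, mul_assoc]

/-- Explicit expression of a codeword as a combination of the maps `traceRankOne`. -/
theorem sum_trace_smul_traceRankOne [DecidableEq L]
    (hK : Fintype.card K = 2) (hL : Fintype.card L = 16)
    (a b c : L) :
    ∑ β : Lˣ, (Algebra.trace K L (a * (β : L) ^ 7) + Algebra.trace K L (b * (β : L) ^ 6)
      + Algebra.trace K L (c * (β : L) ^ 4)) • traceRankOne K β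
      = gabidulinEncode K L (a, b, c) := by
  ext x
  simp only [LinearMap.sum_apply, LinearMap.smul_apply, traceRankOne_apply hK hL,
    gabidulinEncode_apply hK]
  simp only [Algebra.smul_def, map_add, mul_add, add_mul, ← mul_assoc,
    Finset.sum_add_distrib, ← Finset.sum_mul, sum_trace_mul_pow hK hL]
  norm_num [Finset.sum_range_succ]

theorem range_gabidulinEncode_le_span_traceRankOne
    (hK : Fintype.card K = 2) (hL : Fintype.card L = 16) :
    LinearMap.range (gabidulinEncode K L) ≤ span K (Set.range (traceRankOne (L := L) K)) := by
  rintro _ ⟨⟨a, b, c⟩, rfl⟩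
  classical
  rw [← sum_trace_smul_traceRankOne hK hL]
  exact sum_mem fun β _ => smul_mem _ _ (subset_span (Set.mem_range_self β))

/-- All the maps `traceRankOne` are congruent to `x ↦ x ^ 8` modulo the code. -/
theorem finrank_span_traceRankOne_le (hK : Fintype.card K = 2) (hL : Fintype.card L = 16) :
    finrank K (span K (Set.range (traceRankOne (L := L) K))) ≤ 13 := by
  have hle : span K (Set.range (traceRankOne (L := L) K)) ≤
      LinearMap.range (gabidulinEncode K L) ⊔ span K {traceRankOne K (1 : Lˣ)} := by
    rw [span_le]
    rintro _ ⟨β, rfl⟩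
    refine mem_sup.2 ⟨_, ⟨((β : L) ^ 8 - 1, (β : L) ^ 9 - 1, (β : L) ^ 11 - 1), rfl⟩, _,
      mem_span_singleton_self _, ?_⟩
    ext x
    rw [LinearMap.add_apply, gabidulinEncode_apply hK, traceRankOne_apply hK hL,
      traceRankOne_apply hK hL, units_pow_fifteen hL, units_pow_fifteen hL, Units.val_one]
    ring
  refine (Submodule.finrank_mono hle).trans
    ((Submodule.finrank_add_le_finrank_add_finrank _ _).trans ?_)
  rw [finrank_range_gabidulinEncode hK hL]
  have : finrank K (span K {traceRankOne K (1 : Lˣ)}) ≤ 1 := by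
    simpa using finrank_span_le_card (R := K) {traceRankOne K (1 : Lˣ)}
  omega

end GabidulinTensorRank


/-- The tensor rank of the Gabidulin code `G_{3,1} = {x ↦ a·x + b·x^2 + c·x^4}` in
`L/K` with `|K| = 2` and `|L| = 16` equals `13`; in particular it is MTR. -/
theorem stmt_11 (K L : Type*) [Field K] [Field L] [Algebra K L]
    [Fintype K] [Fintype L]
    (hK : Fintype.card K = 2) (hL : Fintype.card L = 16) :
    IsLeast {R : ℕ | ∃ f : Fin R → (L →ₗ[K] L),
      (∀ i, Module.finrank K (LinearMap.range (f i)) = 1) ∧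
      ∀ g : L →ₗ[K] L, (∃ a b c : L, ∀ x : L, g x = a * x + b * x ^ 2 + c * x ^ 4) →
        g ∈ Submodule.span K (Set.range f)} 13 := by
  have hcode : ∀ S : Submodule K (L →ₗ[K] L),
      (∀ g : L →ₗ[K] L, (∃ a b c : L, ∀ x : L, g x = a * x + b * x ^ 2 + c * x ^ 4) → g ∈ S) ↔
        LinearMap.range (gabidulinEncode K L) ≤ S := by
    refine fun S => ⟨?_, ?_⟩
    · rintro h _ ⟨⟨a, b, c⟩, rfl⟩
      exact h _ ⟨a, b, c, gabidulinEncode_apply hK a b c⟩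
    · rintro h g ⟨a, b, c, hg⟩
      refine h ⟨(a, b, c), LinearMap.ext fun x => ?_⟩
      rw [gabidulinEncode_apply hK, hg]
  simp only [hcode]
  constructor
  · obtain ⟨f, hfs, hfspan, -⟩ :=
      Submodule.exists_fun_fin_finrank_span_eq K (Set.range (traceRankOne (L := L) K))
    have hf : ∀ i, Module.finrank K (LinearMap.range (f i)) = 1 := fun i => by
      obtain ⟨β, hβ⟩ := hfs i
      rw [← hβ, finrank_range_traceRankOne]
    have hspan := (range_gabidulinEncode_le_span_traceRankOne hK hL).trans_eq hfspan.symm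
    have hcard := le_antisymm (finrank_span_traceRankOne_le hK hL)
      (thirteen_le_of_range_gabidulinEncode_le_span hK hL f hf hspan)
    rw [← hcard]
    exact ⟨f, hf, hspan⟩
  · rintro R ⟨f, hf, hspan⟩
    exact thirteen_le_of_range_gabidulinEncode_le_span hK hL f hf hspan
end

section
/- Let K be the field with 3 elements and let L be a field extension of K with 81 elements. Then the tensor rank of the Gabidulin code G = {x ↦ a·x + b·x^3 + c·x^9 : a, b, c ∈ L} equals 13; that is, 13 is the least natural number R for which there exist R rank-one K-linear maps f_1, …, f_R : L → L such that G is contained in the K-linear span of {f_1, …, f_R}. In particular, G is a minimum tensor rank code (it attains the Kruskal lower bound 12 + 2 − 1 = 13). -/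
open Module

namespace Gabidulin

open Polynomial in
/-- A polynomial over a finite field `L` of degree less than `|L| - 1` that vanishes at all units is
zero. -/
lemma eq_zero_of_forall_eval_eq_zero {L : Type*} [Field L] [Fintype L]
    (p : L[X]) (hp : p.natDegree + 1 < Fintype.card L) (h : ∀ w ≠ 0, p.eval w = 0) : p = 0 := by
  classical
  refine eq_zero_of_natDegree_lt_card_of_eval_eq_zero' p (Finset.univ.erase 0)
    (fun w hw ↦ h w (Finset.ne_of_mem_erase hw)) ?_
  rw [Finset.card_erase_of_mem (Finset.mem_univ _), Finset.card_univ]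
  lia

section

variable (K L : Type*) [Field K] [Field L] [Algebra K L] [Fintype K]

/-- The map `(a, b, c) ↦ (x ↦ a x + b x ^ q + c x ^ q ^ 2)`, where `q = |K|`. -/
noncomputable def encode : (L × L × L) →ₗ[K] (L →ₗ[K] L) :=
  let φ := (FiniteField.frobeniusAlgHom K L).toLinearMap
  (LinearMap.mul K L).coprod
    ((((LinearMap.lcomp K L φ) ∘ₗ LinearMap.mul K L)).coprod
      ((LinearMap.lcomp K L (φ ∘ₗ φ)) ∘ₗ LinearMap.mul K L))

/-- The map `((a, b, c), t) ↦ (x ↦ a x + b x ^ q + c x ^ q ^ 2 + t x ^ q ^ 3)`, where `q = |K|` and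
`t ∈ K`. -/
noncomputable def encodeExt : ((L × L × L) × K) →ₗ[K] (L →ₗ[K] L) :=
  let φ := (FiniteField.frobeniusAlgHom K L).toLinearMap
  (encode K L).coprod (LinearMap.toSpanSingleton K _ (φ ∘ₗ φ ∘ₗ φ))

end

variable {K L : Type*} [Field K] [Field L] [Algebra K L] [Fintype K]

lemma encode_apply (hK : Fintype.card K = 3) (v : L × L × L) (x : L) :
    encode K L v x = v.1 * x + v.2.1 * x ^ 3 + v.2.2 * x ^ 9 := by
  simp [encode, hK, ← pow_mul, add_assoc]

lemma encodeExt_apply (hK : Fintype.card K = 3) (v : (L × L × L) × K) (x : L) :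
    encodeExt K L v x =
      v.1.1 * x + v.1.2.1 * x ^ 3 + v.1.2.2 * x ^ 9 + algebraMap K L v.2 * x ^ 27 := by
  simp [encodeExt, encode_apply hK, hK, ← pow_mul, Algebra.smul_def]

variable [Fintype L]

lemma finrank_eq_four (hK : Fintype.card K = 3) (hL : Fintype.card L = 81) :
    finrank K L = 4 := by
  have h := Module.card_eq_pow_finrank (K := K) (V := L)
  rw [hK, hL] at h
  exact (Nat.pow_right_injective (by norm_num : 2 ≤ 3)
    (h.symm.trans (by norm_num : 81 = 3 ^ 4)))

lemma algebraMap_trace (hK : Fintype.card K = 3) (hL : Fintype.card L = 81) (x : L) :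
    algebraMap K L (Algebra.trace K L x) = x + x ^ 3 + x ^ 9 + x ^ 27 := by
  rw [FiniteField.algebraMap_trace_eq_sum_pow, finrank_eq_four hK hL, Nat.card_eq_fintype_card, hK]
  simp [Finset.sum_range_succ]

lemma exists_eq_trace_mul (ψ : L →ₗ[K] K) : ∃ α, ∀ x, ψ x = Algebra.trace K L (α * x) := by
  obtain ⟨α, hα⟩ := (LinearMap.BilinForm.toDual _ (traceForm_nondegenerate K L)).surjective ψ
  exact ⟨α, fun x ↦ by rw [← hα, LinearMap.BilinForm.toDual_def, Algebra.traceForm_apply]⟩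

open Polynomial in
lemma eq_zero_of_encode_vanishes_on (hK : Fintype.card K = 3) (v : L × L × L) (s : Submodule K L)
    (hs : 3 ≤ finrank K s) (h : ∀ x ∈ s, encode K L v x = 0) : v = 0 := by
  classical
  obtain ⟨a, b, c⟩ := v
  have hp : C a * X + C b * X ^ 3 + C c * X ^ 9 = 0 := by
    refine eq_zero_of_natDegree_lt_card_of_eval_eq_zero _ (Subtype.val_injective (p := (· ∈ s)))
      (fun x ↦ by simpa [encode_apply hK] using h x x.2) ?_
    have hd : (C a * X + C b * X ^ 3 + C c * X ^ 9).natDegree ≤ 9 := by compute_degree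
    have hc : Fintype.card s = 3 ^ finrank K s := by
      rw [Module.card_eq_pow_finrank (K := K) (V := s), hK]
    calc _ ≤ 9 := hd
      _ < 3 ^ 3 := by norm_num
      _ ≤ 3 ^ finrank K s := Nat.pow_le_pow_right (by norm_num) hs
      _ = _ := hc.symm
  have h1 := congrArg (coeff · 1) hp
  have h3 := congrArg (coeff · 3) hp
  have h9 := congrArg (coeff · 9) hp
  simp at h1 h3 h9
  simp [h1, h3, h9]

lemma encode_injective (hK : Fintype.card K = 3) (hL : Fintype.card L = 81) :
    Function.Injective (encode K L) := by
  rw [injective_iff_map_eq_zero]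
  refine fun v hv ↦ eq_zero_of_encode_vanishes_on hK v ⊤ ?_ (by simp [hv])
  rw [finrank_top, finrank_eq_four hK hL]
  norm_num

lemma finrank_range_encode (hK : Fintype.card K = 3) (hL : Fintype.card L = 81) :
    finrank K (LinearMap.range (encode K L)) = 12 := by
  rw [LinearMap.finrank_range_of_inj (encode_injective hK hL)]
  simp [finrank_eq_four hK hL]

/-- The Gabidulin code contains no map of rank one. -/
lemma finrank_range_encode_apply_ne_one (hK : Fintype.card K = 3) (hL : Fintype.card L = 81)
    (v : L × L × L) : finrank K (LinearMap.range (encode K L v)) ≠ 1 := by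
  intro h
  have h4 := (encode K L v).finrank_range_add_finrank_ker
  rw [finrank_eq_four hK hL] at h4
  have hv : v = 0 := eq_zero_of_encode_vanishes_on hK v (LinearMap.ker (encode K L v))
    (by lia) (fun x hx ↦ hx)
  rw [hv, map_zero, LinearMap.range_zero, finrank_bot] at h
  exact zero_ne_one h

/-- Coordinates, with respect to `encodeExt`, of the rank-one map `x ↦ w ^ 27 * Tr (w⁻¹ * x)`. -/
def rankOneCoords (K : Type*) {L : Type*} [Field K] [Field L] (w : L) : (L × L × L) × K :=
  ((w ^ 26, w ^ 24, w ^ 18), 1)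

lemma encodeExt_rankOneCoords (hK : Fintype.card K = 3) (hL : Fintype.card L = 81)
    {w : L} (hw : w ≠ 0) :
    encodeExt K L (rankOneCoords K w) =
      (Algebra.trace K L ∘ₗ LinearMap.mulLeft K w⁻¹).smulRight (w ^ 27) := by
  ext x
  simp only [encodeExt_apply hK, rankOneCoords, LinearMap.smulRight_apply, LinearMap.comp_apply,
    LinearMap.mulLeft_apply, Algebra.smul_def, algebraMap_trace hK hL, map_one]
  field_simp

lemma finrank_range_encodeExt_rankOneCoords (hK : Fintype.card K = 3) (hL : Fintype.card L = 81)
    {w : L} (hw : w ≠ 0) :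
    finrank K (LinearMap.range (encodeExt K L (rankOneCoords K w))) = 1 := by
  rw [encodeExt_rankOneCoords hK hL hw, LinearMap.range_smulRight_apply_of_surjective,
    finrank_span_singleton (pow_ne_zero _ hw)]
  refine (Algebra.trace_surjective K L).comp fun x ↦ ⟨w * x, ?_⟩
  simp [hw]

open Polynomial in
lemma span_rankOneCoords (hK : Fintype.card K = 3) (hL : Fintype.card L = 81) :
    Submodule.span K (rankOneCoords K '' {w : L | w ≠ 0}) = ⊤ := by
  by_contra hne
  obtain ⟨ℓ, hℓ, hker⟩ := Submodule.exists_le_ker_of_lt_top _ (lt_top_iff_ne_top.2 hne)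
  obtain ⟨α, hα⟩ := exists_eq_trace_mul (ℓ ∘ₗ .inl K _ _ ∘ₗ .inl K L (L × L))
  obtain ⟨β, hβ⟩ := exists_eq_trace_mul (ℓ ∘ₗ .inl K _ _ ∘ₗ .inr K L (L × L) ∘ₗ .inl K L L)
  obtain ⟨γ, hγ⟩ := exists_eq_trace_mul (ℓ ∘ₗ .inl K _ _ ∘ₗ .inr K L (L × L) ∘ₗ .inr K L L)
  set t : K := ℓ (0, 1) with ht
  have key (a b c : L) (s : K) : ℓ ((a, b, c), s) = Algebra.trace K L (α * a) +
      Algebra.trace K L (β * b) + Algebra.trace K L (γ * c) + s * t := by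
    rw [← hα, ← hβ, ← hγ, ht, ← smul_eq_mul, ← map_smul]
    simp only [LinearMap.comp_apply, ← map_add]
    simp
  have hp : C α * X ^ 26 + C (α ^ 3) * X ^ 78 + C (α ^ 9) * X ^ 74 + C (α ^ 27) * X ^ 62
      + (C β * X ^ 24 + C (β ^ 3) * X ^ 72 + C (β ^ 9) * X ^ 56 + C (β ^ 27) * X ^ 8)
      + (C γ * X ^ 18 + C (γ ^ 3) * X ^ 54 + C (γ ^ 9) * X ^ 2 + C (γ ^ 27) * X ^ 6)
      + C (algebraMap K L t) = 0 := by
    refine eq_zero_of_forall_eval_eq_zero _ ?_ fun w hw ↦ ?_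
    · rw [hL]
      exact Nat.succ_lt_succ (Nat.lt_of_le_of_lt (m := 78) (by compute_degree) (by norm_num))
    · have h80 : w ^ 80 = 1 := by simpa [hL] using FiniteField.pow_card_sub_one_eq_one w hw
      have hw0 : ℓ (rankOneCoords K w) = 0 := hker (Submodule.subset_span ⟨w, hw, rfl⟩)
      have hw1 := congrArg (algebraMap K L) hw0
      rw [rankOneCoords, key, one_mul] at hw1
      simp only [map_add, algebraMap_trace hK hL, mul_pow, ← pow_mul, map_zero] at hw1
      have red (m k : ℕ) : w ^ (m + 80 * k) = w ^ m := by simp [pow_add, pow_mul, h80]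
      have e1 := red 74 2
      have e2 := red 62 8
      have e3 := red 56 2
      have e4 := red 8 8
      have e5 := red 2 2
      have e6 := red 6 6
      norm_num at hw1 e1 e2 e3 e4 e5 e6
      rw [e1, e2, e3, e4, e5, e6] at hw1
      simpa using hw1
  have h26 := congrArg (coeff · 26) hp
  have h24 := congrArg (coeff · 24) hp
  have h18 := congrArg (coeff · 18) hp
  have h0 := congrArg (coeff · 0) hp
  simp [coeff_C, coeff_X_pow, -map_pow] at h26 h24 h18 h0
  refine hℓ (LinearMap.ext fun ⟨⟨a, b, c⟩, s⟩ ↦ ?_)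
  rw [key, h26, h24, h18, h0]
  simp

end Gabidulin

open Gabidulin in
/-- The tensor rank of the Gabidulin code `G_{3,1} = {x ↦ a·x + b·x^3 + c·x^9}` in
`L/K` with `|K| = 3` and `|L| = 81` equals `13`; in particular it is MTR. -/
theorem stmt_12 (K L : Type*) [Field K] [Field L] [Algebra K L]
    [Fintype K] [Fintype L]
    (hK : Fintype.card K = 3) (hL : Fintype.card L = 81) :
    IsLeast {R : ℕ | ∃ f : Fin R → (L →ₗ[K] L),
      (∀ i, Module.finrank K (LinearMap.range (f i)) = 1) ∧
      ∀ g : L →ₗ[K] L, (∃ a b c : L, ∀ x : L, g x = a * x + b * x ^ 3 + c * x ^ 9) →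
        g ∈ Submodule.span K (Set.range f)} 13 := by
  have hmem (g : L →ₗ[K] L) : (∃ a b c : L, ∀ x, g x = a * x + b * x ^ 3 + c * x ^ 9) ↔
      g ∈ LinearMap.range (encode K L) := by
    constructor
    · rintro ⟨a, b, c, h⟩
      exact ⟨(a, b, c), LinearMap.ext fun x ↦ by rw [encode_apply hK, h]⟩
    · rintro ⟨⟨a, b, c⟩, rfl⟩
      exact ⟨a, b, c, encode_apply hK _⟩
  simp only [hmem]
  constructor
  · obtain ⟨s, hs, hspan, hli⟩ :=
      exists_linearIndependent K (rankOneCoords K '' {w : L | w ≠ 0})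
    rw [span_rankOneCoords hK hL] at hspan
    have b := Basis.mk hli (by simp [hspan])
    have : Fintype s := Fintype.ofFinite s
    have hcard : Fintype.card s = 13 := by
      rw [← finrank_eq_card_basis b]
      simp [finrank_eq_four hK hL]
    let e := (Fintype.equivFinOfCardEq hcard).symm
    refine ⟨fun i ↦ encodeExt K L (e i), fun i ↦ ?_, ?_⟩
    · obtain ⟨w, hw, hwi⟩ := hs (e i).2
      beta_reduce
      rw [← hwi]
      exact finrank_range_encodeExt_rankOneCoords hK hL hw
    · rintro _ ⟨v, rfl⟩
      have hrange : Set.range (fun i ↦ encodeExt K L (e i)) = encodeExt K L '' s := by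
        rw [← Function.comp_def (encodeExt K L), Set.range_comp, ← Function.comp_def Subtype.val,
          e.surjective.range_comp, Subtype.range_coe]
      rw [hrange, Submodule.span_image, hspan]
      exact ⟨(v, 0), trivial, by simp [encodeExt]⟩
  · rintro R ⟨f, hf, hspan⟩
    by_contra! hR
    have hle : LinearMap.range (encode K L) ≤ Submodule.span K (Set.range f) := hspan
    have hrank : finrank K (Submodule.span K (Set.range f)) ≤ R := by
      simpa [Set.finrank] using finrank_range_le_card (R := K) f
    have h12 := finrank_range_encode hK hL
    have heq := Submodule.eq_of_le_of_finrank_le hle (by lia)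
    have hpos : 0 < R := by
      have := Submodule.finrank_mono hle
      lia
    obtain ⟨v, hv⟩ : f ⟨0, hpos⟩ ∈ LinearMap.range (encode K L) :=
      heq ▸ Submodule.subset_span ⟨_, rfl⟩
    exact finrank_range_encode_apply_ne_one hK hL v (hv ▸ hf _)
end

section
/- Let K be a field with 4 elements and let L be a field extension of K with 256 elements. Then there exist 8 rank-one K-linear maps f_1, …, f_8 : L → L such that every map of the form x ↦ a·x with a ∈ L lies in the K-linear span of {f_1, …, f_8}. Equivalently, the tensor rank of the code G_{1,1} = {x ↦ a·x : a ∈ L} is at most 8. -/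
/-- A field with `256` elements has characteristic two. -/
lemma charP_two_of_card_eq_256 {L : Type*} [Field L] [Fintype L]
    (hL : Fintype.card L = 256) : CharP L 2 := by
  refine CharTwo.of_one_ne_zero_of_two_eq_zero one_ne_zero ?_
  have h : ((256 : ℕ) : L) = 0 := by rw [← hL]; exact Nat.cast_card_eq_zero L
  have h' : (2 : L) ^ 8 = 0 := by rw [← h]; norm_num
  exact pow_eq_zero_iff (by norm_num) |>.mp h'

lemma octic_root_pow_eq_one {F : Type*} [Field F] [CharP F 2] {α : F}
    (hα : α ^ 8 + α ^ 6 + α ^ 4 + α ^ 3 + α ^ 2 + α + 1 = 0) : α ^ 255 = 1 := by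
  grind

/-- A field with `256` elements contains a root of `X⁸ + X⁶ + X⁴ + X³ + X² + X + 1`. -/
lemma exists_root_octic {L : Type*} [Field L] [Fintype L] (hL : Fintype.card L = 256) :
    ∃ α : L, α ^ 8 + α ^ 6 + α ^ 4 + α ^ 3 + α ^ 2 + α + 1 = 0 := by
  have := charP_two_of_card_eq_256 hL
  let A := AlgebraicClosure L
  have : CharP A 2 := charP_of_injective_algebraMap (algebraMap L A).injective 2
  obtain ⟨γ, hγ⟩ : ∃ γ : A, γ ^ 8 + γ ^ 6 + γ ^ 4 + γ ^ 3 + γ ^ 2 + γ + 1 = 0 := by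
    let p : Polynomial A := .X ^ 8 + .X ^ 6 + .X ^ 4 + .X ^ 3 + .X ^ 2 + .X + 1
    have hp : p.degree = 8 := by
      simp only [p]
      compute_degree!
    obtain ⟨γ, hγ⟩ := IsAlgClosed.exists_root p (by rw [hp]; norm_num)
    exact ⟨γ, by simpa [p] using hγ⟩
  have h256 : γ ^ 256 = γ := by rw [pow_succ, octic_root_pow_eq_one hγ, one_mul]
  have hsplit : (Polynomial.X ^ 256 - Polynomial.X : Polynomial L).Splits := by
    rw [← hL]
    refine Polynomial.splits_iff_card_roots.mpr ?_
    rw [FiniteField.roots_X_pow_card_sub_X,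
      FiniteField.X_pow_card_sub_X_natDegree_eq L Fintype.one_lt_card]
    rfl
  obtain ⟨α, rfl⟩ : γ ∈ (algebraMap L A).range :=
    hsplit.mem_range_of_isRoot (FiniteField.X_pow_card_sub_X_ne_zero L (by norm_num))
      (by simp [h256])
  exact ⟨α, (algebraMap L A).injective (by simpa using hγ)⟩

/-- The power sums `∑ i, α ^ (n * 2 ^ i)` are traces of powers of `α`. Those listed here are the
coefficients of `x ^ (4 ^ j) * y ^ (4 ^ k)`, with `n = 251 + 4 ^ j + 4 ^ k`, in the decomposition
`mul_eq_sum_trace_mul_trace`. -/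
lemma sum_conjugates_pow {L : Type*} [Field L] [CharP L 2] {α : L}
    (hα : α ^ 8 + α ^ 6 + α ^ 4 + α ^ 3 + α ^ 2 + α + 1 = 0) :
    ∑ i ∈ Finset.range 8, α ^ (253 * 2 ^ i) = 1 ∧
    ∀ n ∈ ({256, 268, 316, 259, 271, 319, 283, 331, 379} : Finset ℕ),
      ∑ i ∈ Finset.range 8, α ^ (n * 2 ^ i) = 0 := by
  have h255 := octic_root_pow_eq_one hα
  have hmod (n : ℕ) : ∑ i ∈ Finset.range 8, α ^ (n * 2 ^ i) =
      ∑ i ∈ Finset.range 8, α ^ (n * 2 ^ i % 255) :=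
    Finset.sum_congr rfl fun i _ ↦ pow_eq_pow_mod _ h255
  refine ⟨?_, fun n hn ↦ ?_⟩
  · rw [hmod]
    norm_num [Finset.sum_range_succ]
    grind
  · rw [hmod]
    simp only [Finset.mem_insert, Finset.mem_singleton] at hn
    rcases hn with rfl | rfl | rfl | rfl | rfl | rfl | rfl | rfl | rfl <;>
    · norm_num [Finset.sum_range_succ]
      grind

/-- A decomposition of the multiplication of a field with `256` elements as a sum of eight products
of linear forms, permuted by the Frobenius automorphism. -/
lemma mul_eq_sum_trace_mul_trace {L : Type*} [Field L] [CharP L 2] {α : L}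
    (hα : α ^ 8 + α ^ 6 + α ^ 4 + α ^ 3 + α ^ 2 + α + 1 = 0) (x y : L) :
    x * y = ∑ i ∈ Finset.range 8, α ^ (251 * 2 ^ i) *
      (∑ j ∈ Finset.range 4, (α ^ 2 ^ i * x) ^ 4 ^ j) *
      (∑ k ∈ Finset.range 4, (α ^ 2 ^ i * y) ^ 4 ^ k) := by
  obtain ⟨h1, h0⟩ := sum_conjugates_pow hα
  have key (j k : ℕ) (hj : j ∈ Finset.range 4) (hk : k ∈ Finset.range 4) :
      ∑ i ∈ Finset.range 8, α ^ (251 * 2 ^ i) * (α ^ 2 ^ i * x) ^ 4 ^ j *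
        (α ^ 2 ^ i * y) ^ 4 ^ k = if j = 0 ∧ k = 0 then x * y else 0 := by
    have : ∑ i ∈ Finset.range 8, α ^ (251 * 2 ^ i) * (α ^ 2 ^ i * x) ^ 4 ^ j *
        (α ^ 2 ^ i * y) ^ 4 ^ k =
        (∑ i ∈ Finset.range 8, α ^ ((251 + 4 ^ j + 4 ^ k) * 2 ^ i)) *
          (x ^ 4 ^ j * y ^ 4 ^ k) := by
      rw [Finset.sum_mul]
      exact Finset.sum_congr rfl fun i _ ↦ by ring
    rw [this]
    split_ifs with h
    · obtain ⟨rfl, rfl⟩ := h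
      simp [h1]
    · rw [h0, zero_mul]
      simp only [Finset.mem_range] at hj hk
      clear this
      interval_cases j <;> interval_cases k <;> simp at h ⊢
  simp_rw [mul_assoc, Finset.sum_mul_sum, Finset.mul_sum, ← mul_assoc]
  rw [Finset.sum_comm]
  simp_rw [Finset.sum_comm (s := Finset.range 8)]
  rw [Finset.sum_congr rfl fun j hj ↦ Finset.sum_congr rfl fun k hk ↦ key j k hj hk]
  simp [Finset.sum_range_succ]

/-- For `|K| = 4` and `|L| = 256`, there are `8` rank-one `K`-linear maps of `L` whose
`K`-span contains every multiplication map `x ↦ a·x`; i.e. the tensor rank of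
`G_{1,1}` is at most `8`. -/
theorem stmt_13 (K L : Type*) [Field K] [Field L] [Algebra K L]
    [Fintype K] [Fintype L]
    (hK : Fintype.card K = 4) (hL : Fintype.card L = 256) :
    ∃ f : Fin 8 → (L →ₗ[K] L),
      (∀ i, Module.finrank K (LinearMap.range (f i)) = 1) ∧
      ∀ g : L →ₗ[K] L, (∃ a : L, ∀ x : L, g x = a * x) →
        g ∈ Submodule.span K (Set.range f) := by
  have := charP_two_of_card_eq_256 hL
  obtain ⟨α, hα⟩ := exists_root_octic hL
  have hα0 : α ≠ 0 := by
    rintro rfl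
    norm_num at hα
  have hdim : Module.finrank K L = 4 := by
    have h := Module.card_eq_pow_finrank (K := K) (V := L)
    rw [hK, hL] at h
    exact (Nat.pow_right_injective (by norm_num : 2 ≤ 4) (by simpa using h)).symm
  have htrace (x : L) : algebraMap K L (Algebra.trace K L x) =
      ∑ j ∈ Finset.range 4, x ^ 4 ^ j := by
    rw [FiniteField.algebraMap_trace_eq_sum_pow, hdim, Nat.card_eq_fintype_card, hK]
  let φ (i : Fin 8) : L →ₗ[K] K := Algebra.trace K L ∘ₗ LinearMap.mulLeft K (α ^ 2 ^ (i : ℕ))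
  refine ⟨fun i ↦ (φ i).smulRight (α ^ (251 * 2 ^ (i : ℕ))), fun i ↦ ?_, ?_⟩
  · have hφ : φ i ≠ 0 := fun h ↦ Algebra.trace_ne_zero K L <| by
      ext x
      have hx := LinearMap.congr_fun h ((α ^ 2 ^ (i : ℕ))⁻¹ * x)
      rwa [LinearMap.comp_apply, LinearMap.mulLeft_apply,
        mul_inv_cancel_left₀ (pow_ne_zero _ hα0)] at hx
    rw [LinearMap.range_smulRight_apply hφ]
    exact finrank_span_singleton (pow_ne_zero _ hα0)
  · rintro g ⟨a, ha⟩
    have hg : g = ∑ i : Fin 8, φ i a • (φ i).smulRight (α ^ (251 * 2 ^ (i : ℕ))) := by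
      ext x
      rw [ha, mul_eq_sum_trace_mul_trace hα, Finset.sum_range]
      simp only [LinearMap.sum_apply, LinearMap.smul_apply, LinearMap.smulRight_apply]
      simp only [Algebra.smul_def, φ, LinearMap.comp_apply, LinearMap.mulLeft_apply, htrace]
      exact Finset.sum_congr rfl fun i _ ↦ by ring
    rw [hg]
    exact Submodule.sum_mem _ fun i _ ↦
      Submodule.smul_mem _ _ (Submodule.subset_span ⟨i, rfl⟩)
end

section
/- Let K be the field with 5 elements and let L be a field extension of K with 625 elements. Then there exist 8 rank-one K-linear maps f_1, …, f_8 : L → L such that every map of the form x ↦ a·x with a ∈ L lies in the K-linear span of {f_1, …, f_8}. Equivalently, the tensor rank of the code G_{1,1} = {x ↦ a·x : a ∈ L} is at most 8. -/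
/-- The linear forms of a rank-8 decomposition of multiplication in `𝔽₅[h]/(h⁴ - 2)`, as rows of
coordinates in the basis `1, h, h², h³`. They form two Frobenius orbits. -/
def formCoeff : Fin 8 → Fin 4 → ℕ :=
  ![![1, 0, 1, 2],
    ![1, 0, 4, 1],
    ![1, 0, 1, 3],
    ![1, 0, 4, 4],
    ![1, 1, 2, 1],
    ![1, 2, 3, 3],
    ![1, 4, 2, 4],
    ![1, 3, 3, 2]]

/-- The vectors of a rank-8 decomposition of multiplication in `𝔽₅[h]/(h⁴ - 2)`, as rows of
coordinates in the basis `1, h, h², h³`. -/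
def vecCoeff : Fin 8 → Fin 4 → ℕ :=
  ![![1, 0, 1, 1],
    ![1, 0, 4, 2],
    ![1, 0, 1, 4],
    ![1, 0, 4, 3],
    ![3, 4, 4, 2],
    ![3, 2, 1, 4],
    ![3, 1, 4, 3],
    ![3, 3, 1, 1]]

/-- The decomposition of the multiplication of `𝔽₅[h]/(h⁴ - 2)` given by `formCoeff` and `vecCoeff`. -/
theorem sum_form_mul_form_mul_vec {R : Type*} [CommRing R] (h5 : (5 : R) = 0) {h : R}
    (hh : h ^ 4 = 2) (a x : Fin 4 → R) :
    ∑ i, (∑ k, (formCoeff i k : R) * a k) * (∑ k, (formCoeff i k : R) * x k) *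
      (∑ k, (vecCoeff i k : R) * h ^ (k : ℕ)) =
    (∑ k, a k * h ^ (k : ℕ)) * ∑ k, x k * h ^ (k : ℕ) := by
  simp only [Fin.sum_univ_succ, formCoeff, vecCoeff]
  simp
  linear_combination
    ((3 * a 0 * x 0 + 6 * (a 0 * x 1 + a 1 * x 0) + 8 * (a 0 * x 2 + a 2 * x 0) + 8 * (a 0 * x 3 + a 3 * x 0) + 18 * a 1 * x 1 + 15 * (a 1 * x 2 + a 2 * x 1) + 17 * (a 1 * x 3 + a 3 * x 1) + 22 * a 2 * x 2 + 20 * (a 2 * x 3 + a 3 * x 2) + 24 * a 3 * x 3) +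
      (2 * a 0 * x 0 + 4 * (a 0 * x 1 + a 1 * x 0) + 5 * (a 0 * x 2 + a 2 * x 0) + 4 * (a 0 * x 3 + a 3 * x 0) + 11 * a 1 * x 1 + 11 * (a 1 * x 2 + a 2 * x 1) + 10 * (a 1 * x 3 + a 3 * x 1) + 13 * a 2 * x 2 + 10 * (a 2 * x 3 + a 3 * x 2) + 10 * a 3 * x 3) * h ^ 1 +
      (4 * a 0 * x 0 + 5 * (a 0 * x 1 + a 1 * x 0) + 11 * (a 0 * x 2 + a 2 * x 0) + 10 * (a 0 * x 3 + a 3 * x 0) + 16 * a 1 * x 1 + 11 * (a 1 * x 2 + a 2 * x 1) + 16 * (a 1 * x 3 + a 3 * x 1) + 36 * a 2 * x 2 + 28 * (a 2 * x 3 + a 3 * x 2) + 32 * a 3 * x 3) * h ^ 2 +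
      (4 * a 0 * x 0 + 5 * (a 0 * x 1 + a 1 * x 0) + 10 * (a 0 * x 2 + a 2 * x 0) + 11 * (a 0 * x 3 + a 3 * x 0) + 15 * a 1 * x 1 + 12 * (a 1 * x 2 + a 2 * x 1) + 16 * (a 1 * x 3 + a 3 * x 1) + 30 * a 2 * x 2 + 28 * (a 2 * x 3 + a 3 * x 2) + 36 * a 3 * x 3) * h ^ 3) * h5 -
      (a 1 * x 3 + a 2 * x 2 + a 3 * x 1 + (a 2 * x 3 + a 3 * x 2) * h + a 3 * x 3 * h ^ 2) * hh

theorem exists_pow_four_eq_two {L : Type*} [Field L] [Fintype L]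
    (hL : Fintype.card L = 625) (h5 : (5 : L) = 0) : ∃ h : L, h ^ 4 = 2 := by
  have h2 : (2 : L) ≠ 0 := fun h2 ↦ one_ne_zero (α := L) (by linear_combination h5 - 2 * h2)
  have hchar : ringChar L ≠ 2 := fun hc ↦ h2 (by
    have := ringChar.Nat.cast_ringChar (R := L)
    rw [hc] at this
    exact_mod_cast this)
  have h16 : (2 : L) ^ 4 = 1 := by linear_combination 3 * h5
  obtain ⟨s, hs⟩ := (FiniteField.isSquare_iff hchar h2).2 (by
    rw [hL, show 625 / 2 = 4 * 78 from rfl, pow_mul, h16, one_pow])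
  have hs0 : s ≠ 0 := by
    rintro rfl
    exact h2 (by simpa using hs)
  obtain ⟨h, rfl⟩ := (FiniteField.isSquare_iff hchar hs0).2 (by
    rw [hL, show 625 / 2 = 2 * (4 * 39) from rfl, pow_mul, pow_two, ← hs, pow_mul, h16, one_pow])
  exact ⟨h, by linear_combination -hs⟩

/-- The powers of a fourth root of `2` are eigenvectors of Frobenius for distinct eigenvalues. -/
theorem linearIndependent_pow_of_pow_four_eq_two {K L : Type*} [Field K] [Field L] [Algebra K L]
    [Fintype K] (hK : Fintype.card K = 5) {h : L} (hh : h ^ 4 = 2) (h2 : (2 : L) ≠ 0) :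
    LinearIndependent K fun k : Fin 4 ↦ h ^ (k : ℕ) := by
  have : Fact (Nat.Prime 5) := ⟨by norm_num⟩
  have : CharP K 5 := charP_of_card_eq_prime hK
  have h0 : h ≠ 0 := by
    rintro rfl
    exact h2 (by simpa using hh.symm)
  refine Module.End.eigenvectors_linearIndependent'
    (FiniteField.frobeniusAlgHom K L).toLinearMap (fun k : Fin 4 ↦ ((2 ^ (k : ℕ) : ℕ) : K)) ?_ _ ?_
  · intro i j hij
    exact (by decide : ∀ i j : Fin 4, 2 ^ (i : ℕ) ≡ 2 ^ (j : ℕ) [MOD 5] → i = j) i j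
      ((CharP.natCast_eq_natCast K 5).1 hij)
  · intro k
    refine Module.End.hasEigenvector_iff.2 ⟨Module.End.mem_eigenspace_iff.2 ?_, pow_ne_zero _ h0⟩
    have h1 : h ^ 5 = 2 * h := by linear_combination h * hh
    simp only [AlgHom.toLinearMap_apply, FiniteField.frobeniusAlgHom_apply, hK, Algebra.smul_def,
      map_natCast]
    rw [← pow_mul, mul_comm, pow_mul, h1, mul_pow]
    norm_cast

/-- For `|K| = 5` and `|L| = 625`, there are `8` rank-one `K`-linear maps of `L` whose
`K`-span contains every multiplication map `x ↦ a·x`; i.e. the tensor rank of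
`G_{1,1}` is at most `8`. -/
theorem stmt_14 (K L : Type*) [Field K] [Field L] [Algebra K L]
    [Fintype K] [Fintype L]
    (hK : Fintype.card K = 5) (hL : Fintype.card L = 625) :
    ∃ f : Fin 8 → (L →ₗ[K] L),
      (∀ i, Module.finrank K (LinearMap.range (f i)) = 1) ∧
      ∀ g : L →ₗ[K] L, (∃ a : L, ∀ x : L, g x = a * x) →
        g ∈ Submodule.span K (Set.range f) := by
  have : Fact (Nat.Prime 5) := ⟨by norm_num⟩
  have : CharP K 5 := charP_of_card_eq_prime hK
  have : CharP L 5 := charP_of_card_eq_prime_pow (f := 4) (by rw [hL]; norm_num)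
  have h5 : (5 : L) = 0 := by exact_mod_cast CharP.cast_eq_zero L 5
  have h2 : (2 : L) ≠ 0 := fun h2 ↦ one_ne_zero (α := L) (by linear_combination h5 - 2 * h2)
  have hdim : Module.finrank K L = 4 := by
    have := Module.card_eq_pow_finrank (K := K) (V := L)
    rw [hK, hL, show 625 = 5 ^ 4 by norm_num] at this
    exact (Nat.pow_right_injective (by norm_num : 2 ≤ 5) this).symm
  obtain ⟨h, hh⟩ := exists_pow_four_eq_two hL h5
  have hli := linearIndependent_pow_of_pow_four_eq_two hK hh h2
  let b := basisOfLinearIndependentOfCardEqFinrank hli (by simp [hdim])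
  have hb : ∀ k, b k = h ^ (k : ℕ) := fun k ↦ by simp [b]
  let φ : Fin 8 → (L →ₗ[K] K) := fun i ↦ ∑ k, (formCoeff i k : K) • b.coord k
  let w : Fin 8 → L := fun i ↦ ∑ k, (vecCoeff i k : K) • b k
  have hφ : ∀ i, φ i ≠ 0 := fun i hi ↦ by
    have h1 : φ i (b 0) = formCoeff i 0 := by simp [φ, Finsupp.single_apply]
    rw [hi, LinearMap.zero_apply, eq_comm, CharP.cast_eq_zero_iff K 5] at h1
    exact (by decide : ∀ i, ¬ 5 ∣ formCoeff i 0) i h1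
  have hw : ∀ i, w i ≠ 0 := fun i hi ↦ by
    have h1 := Fintype.linearIndependent_iff.1 b.linearIndependent _ hi 0
    rw [CharP.cast_eq_zero_iff K 5] at h1
    exact (by decide : ∀ i, ¬ 5 ∣ vecCoeff i 0) i h1
  refine ⟨fun i ↦ (φ i).smulRight (w i), fun i ↦ ?_, ?_⟩
  · rw [LinearMap.range_smulRight_apply (hφ i), finrank_span_singleton (hw i)]
  · rintro g ⟨a, hg⟩
    have key : g = ∑ i, φ i a • (φ i).smulRight (w i) := by
      ext x
      have hsum : ∀ y : L, ∑ k, algebraMap K L (b.repr y k) * h ^ (k : ℕ) = y := fun y ↦ by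
        simpa only [Algebra.smul_def, hb] using b.sum_repr y
      have := sum_form_mul_form_mul_vec h5 hh (fun k ↦ algebraMap K L (b.repr a k))
        (fun k ↦ algebraMap K L (b.repr x k))
      rw [hsum, hsum] at this
      have hφ_apply : ∀ i y, algebraMap K L (φ i y) =
          ∑ k, (formCoeff i k : L) * algebraMap K L (b.repr y k) := by
        simp [φ]
      rw [hg, ← this]
      simp only [LinearMap.sum_apply, LinearMap.smul_apply, LinearMap.smulRight_apply]
      simp only [Algebra.smul_def, hφ_apply, w, hb, map_natCast, mul_assoc]
    rw [key]
    exact Submodule.sum_mem _ fun i _ ↦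
      Submodule.smul_mem _ _ (Submodule.subset_span ⟨i, rfl⟩)
end

section
/- Let K be a finite field with q elements and let L be a field extension of K with q^4 elements. Let α_1, α_2, α_3, β_1, β_2, β_3 ∈ L and let c_1, c_2 ∈ L satisfy c_1^q = c_1 and c_2^q = c_2. Assume that c_1·α_1·β_1^{q^2} + c_2·α_2·β_2^{q^2} = α_3·β_3^{q^2} and c_1·α_1·β_1^{q^3} + c_2·α_2·β_2^{q^3} = α_3·β_3^{q^3}. Then (c_1·α_1^{q^2}·β_1^{q} + c_2·α_2^{q^2}·β_2^{q}) · (c_1·α_1^{q^3}·β_1^{q^2} + c_2·α_2^{q^3}·β_2^{q^2}) · (c_1·α_1·β_1^{q^3} + c_2·α_2·β_2^{q^3}) · (c_1·α_1^{q}·β_1 + c_2·α_2^{q}·β_2) = (c_1·α_1^{q^2}·β_1 + c_2·α_2^{q^2}·β_2) · (c_1·α_1^{q^3}·β_1^{q} + c_2·α_2^{q^3}·β_2^{q}) · (c_1·α_1·β_1^{q^2} + c_2·α_2·β_2^{q^2}) · (c_1·α_1^{q}·β_1^{q^3} + c_2·α_2^{q}·β_2^{q^3}). -/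
/-- If `f` has order dividing four, both sides of the identity are the product of all
conjugates of `a₃` and `b₃`. -/
theorem norm_condition_of_iterate_four_eq_self {R : Type*} [CommRing R] (f : R →+* R)
    (hf : ∀ x, f (f (f (f x))) = x)
    (a₁ a₂ a₃ b₁ b₂ b₃ c₁ c₂ : R) (hc₁ : f c₁ = c₁) (hc₂ : f c₂ = c₂)
    (h₂ : c₁ * a₁ * f (f b₁) + c₂ * a₂ * f (f b₂) = a₃ * f (f b₃))
    (h₃ : c₁ * a₁ * f (f (f b₁)) + c₂ * a₂ * f (f (f b₂)) = a₃ * f (f (f b₃))) :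
    (c₁ * f (f a₁) * f b₁ + c₂ * f (f a₂) * f b₂) *
      (c₁ * f (f (f a₁)) * f (f b₁) + c₂ * f (f (f a₂)) * f (f b₂)) *
      (c₁ * a₁ * f (f (f b₁)) + c₂ * a₂ * f (f (f b₂))) *
      (c₁ * f a₁ * b₁ + c₂ * f a₂ * b₂) =
    (c₁ * f (f a₁) * b₁ + c₂ * f (f a₂) * b₂) *
      (c₁ * f (f (f a₁)) * f b₁ + c₂ * f (f (f a₂)) * f b₂) *
      (c₁ * a₁ * f (f b₁) + c₂ * a₂ * f (f b₂)) *
      (c₁ * f a₁ * f (f (f b₁)) + c₂ * f a₂ * f (f (f b₂))) := by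
  have h₂₁ := congrArg f h₂
  have h₂₂ := congrArg f h₂₁
  have h₂₃ := congrArg f h₂₂
  have h₃₁ := congrArg f h₃
  have h₃₂ := congrArg f h₃₁
  have h₃₃ := congrArg f h₃₂
  simp only [map_add, map_mul, hc₁, hc₂, hf] at h₂₁ h₂₂ h₂₃ h₃₁ h₃₂ h₃₃
  rw [h₂, h₂₁, h₂₂, h₂₃, h₃, h₃₁, h₃₂, h₃₃]
  ring


/-- Equation (4) of the paper: given the last two equations of System (3), the norm
condition `A(c_1/c_2)^(1+q+q^2+q^3) = 1` holds, written in product form.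
Here `|K| = q` and `|L| = q^4`. -/
theorem stmt_15 (q : ℕ) (K L : Type*) [Field K] [Field L] [Algebra K L]
    [Fintype K] [Fintype L]
    (hK : Fintype.card K = q) (hL : Fintype.card L = q ^ 4)
    (α₁ α₂ α₃ β₁ β₂ β₃ c₁ c₂ : L)
    (hc₁ : c₁ ^ q = c₁) (hc₂ : c₂ ^ q = c₂)
    (h1 : c₁ * α₁ * β₁ ^ q ^ 2 + c₂ * α₂ * β₂ ^ q ^ 2 = α₃ * β₃ ^ q ^ 2)
    (h2 : c₁ * α₁ * β₁ ^ q ^ 3 + c₂ * α₂ * β₂ ^ q ^ 3 = α₃ * β₃ ^ q ^ 3) :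
    (c₁ * α₁ ^ q ^ 2 * β₁ ^ q + c₂ * α₂ ^ q ^ 2 * β₂ ^ q) *
      (c₁ * α₁ ^ q ^ 3 * β₁ ^ q ^ 2 + c₂ * α₂ ^ q ^ 3 * β₂ ^ q ^ 2) *
      (c₁ * α₁ * β₁ ^ q ^ 3 + c₂ * α₂ * β₂ ^ q ^ 3) *
      (c₁ * α₁ ^ q * β₁ + c₂ * α₂ ^ q * β₂) =
    (c₁ * α₁ ^ q ^ 2 * β₁ + c₂ * α₂ ^ q ^ 2 * β₂) *
      (c₁ * α₁ ^ q ^ 3 * β₁ ^ q + c₂ * α₂ ^ q ^ 3 * β₂ ^ q) *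
      (c₁ * α₁ * β₁ ^ q ^ 2 + c₂ * α₂ * β₂ ^ q ^ 2) *
      (c₁ * α₁ ^ q * β₁ ^ q ^ 3 + c₂ * α₂ ^ q * β₂ ^ q ^ 3) := by
  have hf : ∀ x : L, (FiniteField.frobeniusAlgHom K L : L →+* L) x = x ^ q := fun x => by
    simp [hK]
  have h := norm_condition_of_iterate_four_eq_self (FiniteField.frobeniusAlgHom K L : L →+* L)
    (fun x => by
      have hx := FiniteField.pow_card x
      rw [hL] at hx
      rw [hf, hf, hf, hf]
      simpa only [← pow_mul, pow_succ, pow_zero, one_mul] using hx)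
    α₁ α₂ α₃ β₁ β₂ β₃ c₁ c₂ (by rw [hf, hc₁]) (by rw [hf, hc₂])
  have hq₂ : ∀ x : L, (x ^ q) ^ q = x ^ q ^ 2 := fun x => by rw [← pow_mul, sq]
  have hq₃ : ∀ x : L, (x ^ q ^ 2) ^ q = x ^ q ^ 3 := fun x => by rw [← pow_mul, ← pow_succ]
  simp only [hf, hq₂, hq₃] at h
  exact h h1 h2
end
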